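/- Let T = ⟨𝒜, 𝒲, d⟩ be a tag system with all words ω_i nonempty, ω a nonempty word over 𝒜, and P₀ a finite set of formulas in which the variable x⁰ does not occur, such that every formula derivable in Int_{→} is derivable from P₀. If every formula derivable from P₀ is derivable from P_{T,ω,P₀}, then T halts on the input word ω. -/

import Mathlib

/-- Propositional formulas over the signature {→}. -/
inductive Fm : Type
  | var : ℕ → Fm
  | imp : Fm → Fm → Fm
  deriving DecidableEq

/-- Apply a substitution (uniform replacement of variables by formulas). -/
def Fm.subst (σ : ℕ → Fm) : Fm → Fm
  | var n => σ n
  | imp A B => imp (A.subst σ) (B.subst σ)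

/-- Derivability from a set of axioms by modus ponens and substitution. -/
inductive Deriv (P : Set Fm) : Fm → Prop
  | ax {A : Fm} : A ∈ P → Deriv P A
  | mp {A B : Fm} : Deriv P A → Deriv P (A.imp B) → Deriv P B
  | subst (σ : ℕ → Fm) {A : Fm} : Deriv P A → Deriv P (A.subst σ)

/-- The fixed variable x⁰. -/
def x0 : Fm := Fm.var 0

/-- Axioms of the intuitionistic implicational calculus Int_{→}:
A1: x → (y → x), A2: (x → (y → z)) → ((x → y) → (x → z)). -/
def IntAx : Set Fm :=
  { Fm.imp (Fm.var 0) (Fm.imp (Fm.var 1) (Fm.var 0)),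
    Fm.imp (Fm.imp (Fm.var 0) (Fm.imp (Fm.var 1) (Fm.var 2)))
      (Fm.imp (Fm.imp (Fm.var 0) (Fm.var 1)) (Fm.imp (Fm.var 0) (Fm.var 2))) }

/-- A ∨ B abbreviates (A → B) → B. -/
def orF (A B : Fm) : Fm := (A.imp B).imp B

/-- E 0 = x⁰ → x⁰ (i.e. E_1), E (k+1) = E k → x⁰. -/
def E : ℕ → Fm
  | 0 => x0.imp x0
  | n + 1 => (E n).imp x0

/-- The code of the letter a_i (letters are elements of `Fin m`). -/
def code {m : ℕ} (i : Fin m) : Fm := (E i.val).imp (x0.imp (x0.imp x0))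

/-- The formula ▷ = ((x⁰ → x⁰) → x⁰) → x⁰. -/
def tri : Fm := ((x0.imp x0).imp x0).imp x0

/-- Right-nested disjunction of a nonempty list of formulas. -/
def rlist : List Fm → Fm
  | [] => x0
  | [A] => A
  | A :: B :: Bs => orF A (rlist (B :: Bs))

def llistAux : Fm → List Fm → Fm
  | A, [] => A
  | A, B :: Bs => llistAux (orF A B) Bs

/-- Left-nested disjunction of a nonempty list of formulas. -/
def llist : List Fm → Fm
  | [] => x0
  | A :: As => llistAux A As

/-- \overrightarrow{α}: right-nested disjunction of codes of the letters of α. -/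
def rword {m : ℕ} (w : List (Fin m)) : Fm := rlist (w.map code)

/-- \overleftarrow{α}: left-nested disjunction of codes of the letters of α. -/
def lword {m : ℕ} (w : List (Fin m)) : Fm := llist (w.map code)

/-- A substitution instance of a member of M. -/
def SubStar (M : Set Fm) : Set Fm := {F | ∃ A ∈ M, ∃ σ : ℕ → Fm, F = Fm.subst σ A}

/-- Two formulas are unifiable if they have a common substitution instance. -/
def Unifiable (A B : Fm) : Prop := ∃ σ τ : ℕ → Fm, Fm.subst σ A = Fm.subst τ B

/-- The variable v occurs in a formula. -/
def Occurs (v : ℕ) : Fm → Prop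
  | Fm.var w => v = w
  | Fm.imp A B => Occurs v A ∨ Occurs v B

/-- Alphabetic formulas (𝒜-formulas) over the alphabet `Fin m`. -/
inductive AForm (m : ℕ) : Fm → Prop
  | ofCode (i : Fin m) : AForm m (code i)
  | ofOr {A B : Fm} : AForm m A → AForm m B → AForm m (orF A B)

/-- A tag system ⟨𝒜, 𝒲, d⟩ with 𝒜 = Fin m. -/
structure TagSystem where
  m : ℕ
  W : Fin m → List (Fin m)
  d : ℕ

/-- One production step of the tag system: a_i β γ ↦ γ ω_i, |β| = d - 1. -/
def TagStep (T : TagSystem) (ξ ζ : List (Fin T.m)) : Prop :=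
  ∃ (i : Fin T.m) (β γ : List (Fin T.m)),
    β.length = T.d - 1 ∧ ξ = i :: (β ++ γ) ∧ ζ = γ ++ T.W i

/-- ⟹_T : reflexive–transitive closure of the one-step production. -/
def TagSteps (T : TagSystem) : List (Fin T.m) → List (Fin T.m) → Prop :=
  Relation.ReflTransGen (TagStep T)

/-- T halts on α: α produces some word shorter than d. -/
def Halts (T : TagSystem) (α : List (Fin T.m)) : Prop :=
  ∃ β, TagSteps T α β ∧ β.length < T.d

/-- Axioms R1: (▷ → (y ∨ \overrightarrow{az}) ∨ u) → (▷ → (\overleftarrow{ya} ∨ z) ∨ u),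
with y = var 1, z = var 2, u = var 3. -/
def R1Ax (m : ℕ) : Set Fm :=
  {F | ∃ a : Fin m, F =
    (tri.imp (orF (orF (Fm.var 1) (orF (code a) (Fm.var 2))) (Fm.var 3))).imp
      (tri.imp (orF (orF (orF (Fm.var 1) (code a)) (Fm.var 2)) (Fm.var 3)))}

/-- Axioms R2: (▷ → \overleftarrow{ya} ∨ z) → (▷ → y ∨ \overrightarrow{az}). -/
def R2Ax (m : ℕ) : Set Fm :=
  {F | ∃ a : Fin m, F =
    (tri.imp (orF (orF (Fm.var 1) (code a)) (Fm.var 2))).imp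
      (tri.imp (orF (Fm.var 1) (orF (code a) (Fm.var 2))))}

/-- Axioms T1: (▷ → \overrightarrow{a_i α y}) → (▷ → \overrightarrow{y ω_i}), |α| = d - 1. -/
def T1Ax (T : TagSystem) : Set Fm :=
  {F | ∃ (i : Fin T.m) (α : List (Fin T.m)), α.length = T.d - 1 ∧
    F = (tri.imp (rlist (((i :: α).map code) ++ [Fm.var 1]))).imp
      (tri.imp (rlist (Fm.var 1 :: (T.W i).map code)))}

/-- Axioms T2: (▷ → \overrightarrow{a_i α}) → (▷ → \overrightarrow{ω_i}), |α| = d - 1. -/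
def T2Ax (T : TagSystem) : Set Fm :=
  {F | ∃ (i : Fin T.m) (α : List (Fin T.m)), α.length = T.d - 1 ∧
    F = (tri.imp (rword (i :: α))).imp (tri.imp (rword (T.W i)))}

/-- P_T = T1 ∪ T2 ∪ R1 ∪ R2. -/
def PT (T : TagSystem) : Set Fm := T1Ax T ∪ T2Ax T ∪ R1Ax T.m ∪ R2Ax T.m

/-- Axioms H: (▷ → \overrightarrow{α}) → A for 0 < |α| < d and A ∈ P₀. -/
def HAx (T : TagSystem) (P₀ : Finset Fm) : Set Fm :=
  {F | ∃ (α : List (Fin T.m)) (A : Fm), 0 < α.length ∧ α.length < T.d ∧ A ∈ P₀ ∧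
    F = (tri.imp (rword α)).imp A}

/-- P_{T,P₀} = P_T ∪ H. -/
def PTP (T : TagSystem) (P₀ : Finset Fm) : Set Fm := PT T ∪ HAx T P₀

/-- The calculus P_{T,ω,P₀} = {W_ω} ∪ P_T ∪ H. -/
def PTot (T : TagSystem) (ω : List (Fin T.m)) (P₀ : Finset Fm) : Set Fm :=
  insert (tri.imp (rword ω)) (PTP T P₀)

/-- Code(α): the four types of codes of a nonempty word α. -/
def CodeSet {m : ℕ} (α : List (Fin m)) : Set Fm :=
  {F | F = tri.imp (rword α)} ∪
  {F | ∃ α₁ α₂ : List (Fin m), α = α₁ ++ α₂ ∧ 2 ≤ α₁.length ∧ 1 ≤ α₂.length ∧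
    F = tri.imp (orF (rword α₁) (rword α₂))} ∪
  {F | ∃ α₁ α₂ α₃ : List (Fin m), α = α₁ ++ α₂ ++ α₃ ∧
    2 ≤ α₁.length ∧ 2 ≤ α₂.length ∧ 1 ≤ α₃.length ∧
    F = tri.imp (orF (orF (lword α₁) (rword α₂)) (rword α₃))} ∪
  {F | ∃ α₁ α₂ : List (Fin m), α = α₁ ++ α₂ ∧ 3 ≤ α₁.length ∧ 1 ≤ α₂.length ∧
    F = tri.imp (orF (lword α₁) (rword α₂))}

/-- Code_T(ω)*: substitution instances of codes of words produced from ω by T. -/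
def CodeTStar (T : TagSystem) (ω : List (Fin T.m)) : Set Fm :=
  {F | ∃ β, TagSteps T ω β ∧ F ∈ SubStar (CodeSet β)}

/-- ⟨P⟩: one application of modus ponens or substitution to members of P. -/
def StepSet (P : Set Fm) : Set Fm :=
  {B | ∃ A, A ∈ P ∧ A.imp B ∈ P} ∪ {B | ∃ A ∈ P, ∃ σ : ℕ → Fm, B = Fm.subst σ A}

/-- ⟨P⟩_n. -/
def Stages (P : Set Fm) : ℕ → Set Fm
  | 0 => P
  | n + 1 => StepSet (Stages P n)

/-- `E` with `x⁰` replaced by `s`. -/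
def ES (s : Fm) : ℕ → Fm
  | 0 => s.imp s
  | n + 1 => (ES s n).imp s

def codeS {m : ℕ} (s : Fm) (i : Fin m) : Fm := (ES s i.val).imp (s.imp (s.imp s))

def triS (s : Fm) : Fm := ((s.imp s).imp s).imp s

def fsize : Fm → ℕ
  | Fm.var _ => 1
  | Fm.imp A B => fsize A + fsize B + 1

theorem E_subst (σ : ℕ → Fm) (n : ℕ) : (E n).subst σ = ES (σ 0) n := by
  induction n with
  | zero => rfl
  | succ n ih => simp only [E, ES, Fm.subst, ih, x0]

theorem ES_subst (σ : ℕ → Fm) (s : Fm) (n : ℕ) : (ES s n).subst σ = ES (s.subst σ) n := by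
  induction n with
  | zero => rfl
  | succ n ih => simp only [ES, Fm.subst, ih]

theorem code_subst {m : ℕ} (σ : ℕ → Fm) (i : Fin m) : (code i).subst σ = codeS (σ 0) i := by
  simp only [code, codeS, Fm.subst, E_subst, x0]

theorem codeS_subst {m : ℕ} (σ : ℕ → Fm) (s : Fm) (i : Fin m) :
    (codeS s i).subst σ = codeS (s.subst σ) i := by
  simp only [codeS, Fm.subst, ES_subst]

theorem tri_subst (σ : ℕ → Fm) : tri.subst σ = triS (σ 0) := rfl

theorem triS_subst (σ : ℕ → Fm) (s : Fm) : (triS s).subst σ = triS (s.subst σ) := rfl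

theorem orF_subst (σ : ℕ → Fm) (A B : Fm) :
    (orF A B).subst σ = orF (A.subst σ) (B.subst σ) := rfl

theorem subst_comp (σ τ : ℕ → Fm) (A : Fm) :
    (A.subst σ).subst τ = A.subst (fun n => (σ n).subst τ) := by
  induction A with
  | var n => rfl
  | imp A B ha hb => simp only [Fm.subst, ha, hb]

theorem triS_inj {s t : Fm} (h : triS s = triS t) : s = t := by
  simp only [triS, Fm.imp.injEq] at h
  exact h.2

theorem fsize_pos (A : Fm) : 0 < fsize A := by cases A <;> simp [fsize]

theorem ES_size (s : Fm) (n : ℕ) : fsize s < fsize (ES s n) := by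
  cases n <;> simp only [ES, fsize] <;> omega

theorem ES_inj (s : Fm) : ∀ a b : ℕ, ES s a = ES s b → a = b
  | 0, 0, _ => rfl
  | 0, b + 1, h => by
      simp only [ES, Fm.imp.injEq] at h
      have := ES_size s b
      rw [← h.1] at this
      omega
  | a + 1, 0, h => by
      simp only [ES, Fm.imp.injEq] at h
      have := ES_size s a
      rw [h.1] at this
      omega
  | a + 1, b + 1, h => by
      simp only [ES, Fm.imp.injEq] at h
      rw [ES_inj s a b h.1]

theorem codeS_inj {m : ℕ} {s : Fm} {i j : Fin m} (h : codeS s i = codeS s j) : i = j := by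
  simp only [codeS, Fm.imp.injEq] at h
  exact Fin.ext (ES_inj s _ _ h.1)

theorem codeS_ne_orF {m : ℕ} {s : Fm} {i : Fin m} {X Y : Fm} (h : codeS s i = orF X Y) :
    False := by
  simp only [codeS, orF, Fm.imp.injEq] at h
  obtain ⟨h1, h2⟩ := h
  have h3 : Y = s := by
    cases hi : i.val with
    | zero => rw [hi] at h1; simp only [ES, Fm.imp.injEq] at h1; exact h1.2.symm
    | succ n => rw [hi] at h1; simp only [ES, Fm.imp.injEq] at h1; exact h1.2.symm
  have h4 := congrArg fsize h2
  rw [h3] at h4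
  simp only [fsize] at h4
  omega

/-- `A` is a disjunction (arbitrarily bracketed) of the codes (at `s`) of the word. -/
inductive AF {m : ℕ} (s : Fm) : List (Fin m) → Fm → Prop
  | leaf (i : Fin m) : AF s [i] (codeS s i)
  | node {l r : List (Fin m)} {A B : Fm} : AF s l A → AF s r B → AF s (l ++ r) (orF A B)

theorem AF.subst {m : ℕ} {s : Fm} {l : List (Fin m)} {A : Fm} (σ : ℕ → Fm) (h : AF s l A) :
    AF (s.subst σ) l (A.subst σ) := by
  induction h with
  | leaf i => rw [codeS_subst]; exact AF.leaf i
  | node _ _ h1 h2 => rw [orF_subst]; exact AF.node h1 h2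

theorem AF.inv_or {m : ℕ} {s : Fm} {l : List (Fin m)} {X Y : Fm} (h : AF s l (orF X Y)) :
    ∃ l1 l2, l = l1 ++ l2 ∧ AF s l1 X ∧ AF s l2 Y := by
  generalize hF : orF X Y = F at h
  cases h with
  | leaf i => exact (codeS_ne_orF hF.symm).elim
  | node h1 h2 =>
    simp only [orF, Fm.imp.injEq] at hF
    obtain ⟨⟨rfl, _⟩, rfl⟩ := hF
    exact ⟨_, _, rfl, h1, h2⟩

theorem AF.inv_code {m : ℕ} {s : Fm} {l : List (Fin m)} {i : Fin m} (h : AF s l (codeS s i)) :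
    l = [i] := by
  generalize hF : codeS s i = F at h
  cases h with
  | leaf j => rw [codeS_inj hF]
  | node h1 h2 => exact (codeS_ne_orF hF).elim

theorem rlist_cons (A : Fm) {L : List Fm} (h : L ≠ []) : rlist (A :: L) = orF A (rlist L) := by
  cases L with
  | nil => exact (h rfl).elim
  | cons B L => rfl

theorem AF.inv_rlist {m : ℕ} {σ : ℕ → Fm} {y : Fm} (α : List (Fin m)) :
    ∀ {l : List (Fin m)}, AF (σ 0) l ((rlist (α.map code ++ [y])).subst σ) →
      ∃ l2, l = α ++ l2 ∧ AF (σ 0) l2 (y.subst σ) := by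
  induction α with
  | nil => intro l h; exact ⟨l, rfl, h⟩
  | cons a α ih =>
    intro l h
    rw [List.map_cons, List.cons_append, rlist_cons _ (by simp), orF_subst, code_subst] at h
    obtain ⟨l1, l2, rfl, h1, h2⟩ := h.inv_or
    obtain ⟨l3, rfl, h3⟩ := ih h2
    rw [h1.inv_code]
    exact ⟨l3, rfl, h3⟩

theorem AF.inv_rword {m : ℕ} {σ : ℕ → Fm} {α : List (Fin m)} (hα : α ≠ [])
    {l : List (Fin m)} (h : AF (σ 0) l ((rword α).subst σ)) : l = α := by
  rcases List.eq_nil_or_concat α with h0 | ⟨β, b, rfl⟩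
  · exact (hα h0).elim
  · rw [rword, List.concat_eq_append, List.map_append] at h
    obtain ⟨l2, rfl, h2⟩ := AF.inv_rlist β h
    rw [code_subst] at h2
    rw [h2.inv_code, List.concat_eq_append]

theorem AF.rword {m : ℕ} (σ : ℕ → Fm) (w : List (Fin m)) (hw : w ≠ []) :
    AF (σ 0) w ((rword w).subst σ) := by
  induction w with
  | nil => exact (hw rfl).elim
  | cons a w ih =>
    by_cases h : w = []
    · subst h
      show AF (σ 0) [a] ((code a).subst σ)
      rw [code_subst]
      exact AF.leaf a
    · show AF (σ 0) ([a] ++ w) ((rlist (code a :: w.map code)).subst σ)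
      rw [rlist_cons _ (by simpa using h), orF_subst, code_subst]
      exact AF.node (AF.leaf a) (ih h)

/-- The invariant of derivations. -/
def TagInv (T : TagSystem) (ω : List (Fin T.m)) (P₀ : Finset Fm) (F : Fm) : Prop :=
  (∃ G ∈ PTP T P₀, ∃ σ : ℕ → Fm, F = G.subst σ) ∨
  (∃ (s : Fm) (β : List (Fin T.m)) (A : Fm), TagSteps T ω β ∧ AF s β A ∧ F = (triS s).imp A)

theorem PTP_shape {T : TagSystem} {P₀ : Finset Fm} {G : Fm} (h : G ∈ PTP T P₀) :
    ∃ X Y, G = (tri.imp X).imp Y := by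
  rcases h with (((⟨i, α, _, rfl⟩ | ⟨i, α, _, rfl⟩) | ⟨a, rfl⟩) | ⟨a, rfl⟩) | ⟨α, A, _, _, _, rfl⟩
  all_goals exact ⟨_, _, rfl⟩

theorem TagInv.shape {T : TagSystem} {ω : List (Fin T.m)} {P₀ : Finset Fm} {F : Fm}
    (h : TagInv T ω P₀ F) : ∃ s X Y, F = ((triS s).imp X).imp Y ∨ F = (triS s).imp Y := by
  rcases h with ⟨G, hG, σ, rfl⟩ | ⟨s, β, A, _, _, rfl⟩
  · obtain ⟨X, Y, rfl⟩ := PTP_shape hG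
    exact ⟨σ 0, X.subst σ, Y.subst σ, Or.inl rfl⟩
  · exact ⟨s, A, A, Or.inr rfl⟩

theorem not_inv_triS {T : TagSystem} {ω : List (Fin T.m)} {P₀ : Finset Fm} {s : Fm}
    (h : TagInv T ω P₀ (triS s)) : False := by
  obtain ⟨t, X, Y, h | h⟩ := h.shape
  · simp only [triS, Fm.imp.injEq] at h
    obtain ⟨⟨⟨h1, h2⟩, _⟩, _⟩ := h
    have := congrArg fsize (h1.symm.trans h2)
    simp only [fsize] at this
    omega
  · simp only [triS, Fm.imp.injEq] at h
    obtain ⟨⟨⟨h1, h2⟩, h3⟩, _⟩ := h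
    have := congrArg fsize (h1.symm.trans h2)
    have := congrArg fsize (h2.symm.trans h3)
    simp only [fsize] at *
    omega

theorem inv_of_deriv (T : TagSystem) (hW : ∀ i, T.W i ≠ [])
    (hd : 1 ≤ T.d) (ω : List (Fin T.m)) (hω : ω ≠ []) (P₀ : Finset Fm) (hH : ¬ Halts T ω)
    {F : Fm} (h : Deriv (PTot T ω P₀) F) : TagInv T ω P₀ F := by
  have hvar : ∀ A : Fm, A.subst Fm.var = A := by
    intro A
    induction A with
    | var n => rfl
    | imp A B ha hb => simp only [Fm.subst, ha, hb]
  induction h with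
  | ax hA =>
    rcases hA with rfl | hA
    · right
      refine ⟨x0, ω, _, Relation.ReflTransGen.refl, ?_, rfl⟩
      have := AF.rword Fm.var ω hω
      rwa [hvar] at this
    · exact Or.inl ⟨_, hA, Fm.var, (hvar _).symm⟩
  | subst σ _ ih =>
    rcases ih with ⟨G, hG, τ, rfl⟩ | ⟨s, β, A, h1, h2, rfl⟩
    · exact Or.inl ⟨G, hG, _, subst_comp _ _ _⟩
    · exact Or.inr ⟨s.subst σ, β, A.subst σ, h1, h2.subst σ, rfl⟩
  | @mp A B _ _ ihA ihAB =>
    rcases ihAB with ⟨G, hG, σ, hGσ⟩ | ⟨s, β, C, h1, h2, hC⟩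
    swap
    · simp only [Fm.imp.injEq] at hC
      rw [hC.1] at ihA
      exact (not_inv_triS ihA).elim
    obtain ⟨s, β, C, hβ, hAF, hC, hs⟩ : ∃ (s : Fm) (β : List (Fin T.m)) (C : Fm),
        TagSteps T ω β ∧ AF s β C ∧ A = (triS s).imp C ∧ s = σ 0 := by
      obtain ⟨X, Y, rfl⟩ := PTP_shape hG
      simp only [Fm.subst, tri_subst, Fm.imp.injEq] at hGσ
      have hA := hGσ.1
      rcases ihA with ⟨G', hG', τ, hA'⟩ | ⟨s, β, C, h1, h2, hC⟩
      · obtain ⟨X', Y', rfl⟩ := PTP_shape hG'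
        rw [hA] at hA'
        simp only [Fm.subst, tri_subst, triS, Fm.imp.injEq] at hA'
        obtain ⟨⟨⟨h1, h2⟩, _⟩, _⟩ := hA'
        have h3 := congrArg fsize h1.1
        have h4 := congrArg fsize h1.2
        simp only [fsize] at h3 h4
        omega
      · refine ⟨s, β, C, h1, h2, hC, ?_⟩
        rw [hA, Fm.imp.injEq] at hC
        exact (triS_inj hC.1).symm
    subst hs
    subst hC
    rcases hG with (((⟨i, α, hα, rfl⟩ | ⟨i, α, hα, rfl⟩) | ⟨a, rfl⟩) | ⟨a, rfl⟩) |
      ⟨α, A, hα0, hα, _, rfl⟩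
    · simp only [Fm.subst, Fm.imp.injEq] at hGσ
      obtain ⟨⟨_, rfl⟩, rfl⟩ := hGσ
      obtain ⟨l2, rfl, h2⟩ := AF.inv_rlist (i :: α) hAF
      refine Or.inr ⟨σ 0, l2 ++ T.W i, _, hβ.tail ⟨i, α, l2, hα, rfl, rfl⟩, ?_, rfl⟩
      rw [rlist_cons _ (by simpa using hW i), orF_subst]
      exact AF.node h2 (AF.rword σ _ (hW i))
    · simp only [Fm.subst, Fm.imp.injEq] at hGσ
      obtain ⟨⟨_, rfl⟩, rfl⟩ := hGσ
      have := AF.inv_rword (by simp) hAF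
      subst this
      exact Or.inr ⟨σ 0, T.W i, _, hβ.tail ⟨i, α, [], hα, by simp, by simp⟩,
        AF.rword σ _ (hW i), rfl⟩
    · simp only [Fm.subst, orF_subst, code_subst, Fm.imp.injEq] at hGσ
      obtain ⟨⟨_, rfl⟩, rfl⟩ := hGσ
      obtain ⟨l1, lu, rfl, h1, hu⟩ := hAF.inv_or
      obtain ⟨ly, l3, rfl, hy, h3⟩ := h1.inv_or
      obtain ⟨la, lz, rfl, ha, hz⟩ := h3.inv_or
      refine Or.inr ⟨σ 0, _, _, hβ, ?_, rfl⟩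
      rw [← List.append_assoc ly]
      exact AF.node (AF.node (AF.node hy ha) hz) hu
    · simp only [Fm.subst, orF_subst, code_subst, Fm.imp.injEq] at hGσ
      obtain ⟨⟨_, rfl⟩, rfl⟩ := hGσ
      obtain ⟨l1, lz, rfl, h1, hz⟩ := hAF.inv_or
      obtain ⟨ly, la, rfl, hy, ha⟩ := h1.inv_or
      refine Or.inr ⟨σ 0, _, _, hβ, ?_, rfl⟩
      rw [List.append_assoc ly]
      exact AF.node hy (AF.node ha hz)
    · simp only [Fm.subst, Fm.imp.injEq] at hGσ
      obtain ⟨⟨_, rfl⟩, rfl⟩ := hGσ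
      have := AF.inv_rword (List.length_pos_iff.mp hα0) hAF
      subst this
      exact (hH ⟨_, hβ, hα⟩).elim

/-- If Int_{→} ≤ P₀ and P₀ ≤ P_{T,ω,P₀}, then T halts on ω. -/
theorem stmt_18 (T : TagSystem) (hW : ∀ i, T.W i ≠ []) (hd : 1 ≤ T.d)
    (ω : List (Fin T.m)) (hω : ω ≠ []) (P₀ : Finset Fm)
    (hx0 : ∀ A ∈ P₀, ¬ Occurs 0 A)
    (hInt : ∀ A : Fm, Deriv IntAx A → Deriv (↑P₀) A)
    (h : ∀ A : Fm, Deriv (↑P₀) A → Deriv (PTot T ω P₀) A) :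
    Halts T ω := by
  by_contra hH
  have h1 := inv_of_deriv T hW hd ω hω P₀ hH (h _ (hInt _ (Deriv.ax (Or.inl rfl))))
  obtain ⟨s, X, Y, h2 | h2⟩ := h1.shape
  · simp at h2
  · simp [triS] at h2
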